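/- If u' and v' are abelian equivalent words over {0,1,2} such that the concatenation u'·v' is a factor of the ternary Thue–Morse word x = g^ω(0), then C(u',02) = C(v',02). -/

import Mathlib

/-- Number of occurrences of `v` as a scattered subword (subsequence) of `u`. -/
def binomC {α : Type*} [DecidableEq α] (u v : List α) : ℕ := u.sublists.count v

/-- Two words are 2-binomially equivalent. -/
def binEq2 {α : Type*} [DecidableEq α] (u v : List α) : Prop :=
  ∀ x : List α, x.length ≤ 2 → binomC u x = binomC v x

/-- The morphism g : 0 ↦ 012, 1 ↦ 02, 2 ↦ 1. -/
def g : Fin 3 → List (Fin 3) := ![[0,1,2],[0,2],[1]]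

/-- Apply the morphism g to a word. -/
def gWord (w : List (Fin 3)) : List (Fin 3) := w.flatMap g

/-- The prefix g^n(0) of the ternary Thue–Morse word. -/
def gPow (n : ℕ) : List (Fin 3) := gWord^[n] [0]

theorem binomC_nil_right {α : Type*} [DecidableEq α] (u : List α) : binomC u [] = 1 := by
  rw [binomC, (List.sublists_perm_sublists' u).count_eq]
  induction u with
  | nil => simp
  | cons a u ih => simp [List.sublists'_cons, ih, List.count_eq_zero]

theorem binomC_nil_cons {α : Type*} [DecidableEq α] (b : α) (v : List α) :
    binomC [] (b :: v) = 0 := by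
  simp [binomC]

theorem binomC_cons_cons {α : Type*} [DecidableEq α] (a b : α) (u v : List α) :
    binomC (a :: u) (b :: v) = binomC u (b :: v) + if a = b then binomC u v else 0 := by
  simp only [binomC, (List.sublists_perm_sublists' _).count_eq, List.sublists'_cons,
    List.count_append]
  congr 1
  split_ifs with h
  · subst h
    exact List.count_map_of_injective _ _ List.cons_injective _
  · simp [List.count_eq_zero, h]

theorem binomC_singleton {α : Type*} [DecidableEq α] (u : List α) (a : α) :
    binomC u [a] = u.count a := by
  induction u with
  | nil => exact binomC_nil_cons a []
  | cons b u ih => simp [binomC_cons_cons, binomC_nil_right, ih, List.count_cons]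

/-- `Alternates s w t`: the letters 0 and 2 alternate in `w`, the first of them being 0 if `s` is
true and 2 otherwise, and the next one to come after `w` being 0 if `t` is true and 2 otherwise. -/
inductive Alternates : Bool → List (Fin 3) → Bool → Prop
  | nil (s : Bool) : Alternates s [] s
  | one {s t : Bool} {w : List (Fin 3)} : Alternates s w t → Alternates s (1 :: w) t
  | zero {t : Bool} {w : List (Fin 3)} : Alternates false w t → Alternates true (0 :: w) t
  | two {t : Bool} {w : List (Fin 3)} : Alternates true w t → Alternates false (2 :: w) t

namespace Alternates

theorem append {r s t : Bool} {u v : List (Fin 3)} (hu : Alternates r u s)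
    (hv : Alternates s v t) : Alternates r (u ++ v) t := by
  induction hu with
  | nil => exact hv
  | one _ ih => exact (ih hv).one
  | zero _ ih => exact (ih hv).zero
  | two _ ih => exact (ih hv).two

theorem exists_of_append {r t : Bool} {u v : List (Fin 3)} (h : Alternates r (u ++ v) t) :
    ∃ s, Alternates r u s ∧ Alternates s v t := by
  induction u generalizing r with
  | nil => exact ⟨r, .nil r, h⟩
  | cons a u ih =>
    cases h with
    | one h => obtain ⟨s, hu, hv⟩ := ih h; exact ⟨s, hu.one, hv⟩
    | zero h => obtain ⟨s, hu, hv⟩ := ih h; exact ⟨s, hu.zero, hv⟩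
    | two h => obtain ⟨s, hu, hv⟩ := ih h; exact ⟨s, hu.two, hv⟩

theorem of_gWord (w : List (Fin 3)) : Alternates true (gWord w) true := by
  induction w with
  | nil => exact .nil true
  | cons a w ih =>
    refine append (s := true) ?_ ih
    fin_cases a
    · exact .zero (.one (.two (.nil _)))
    · exact .zero (.two (.nil _))
    · exact .one (.nil _)

theorem exists_gPow (n : ℕ) : ∃ t, Alternates true (gPow n) t := by
  cases n with
  | zero => exact ⟨false, .zero (.nil _)⟩
  | succ n =>
    rw [gPow, Function.iterate_succ_apply']
    exact ⟨true, of_gWord _⟩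

theorem count_zero_add {s t : Bool} {w : List (Fin 3)} (h : Alternates s w t) :
    w.count 0 + t.toNat = w.count 2 + s.toNat := by
  induction h <;> simp_all; omega

theorem two_mul_binomC {s t : Bool} {w : List (Fin 3)} (h : Alternates s w t) :
    2 * binomC w [0, 2] + w.count 2 = w.count 2 * (w.count 2 + 2 * s.toNat) := by
  induction h with
  | nil => simp [binomC_nil_cons]
  | one _ ih => simpa [binomC_cons_cons, List.count_cons] using ih
  | zero _ ih =>
    simp [binomC_cons_cons, binomC_singleton] at ih ⊢
    linarith
  | two _ ih =>
    simp [binomC_cons_cons] at ih ⊢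
    linarith

end Alternates

/-- Abelian equivalent halves of a factor of the ternary Thue–Morse word
have the same number of scattered occurrences of 02. -/
theorem binomC_02_of_abelian_factor
    (u' v' : List (Fin 3))
    (hab : ∀ a : Fin 3, u'.count a = v'.count a)
    (hfac : ∃ n : ℕ, (u' ++ v') <:+: gPow n) :
    binomC u' [0, 2] = binomC v' [0, 2] := by
  obtain ⟨n, p, q, hn⟩ := hfac
  obtain ⟨t, ht⟩ := Alternates.exists_gPow n
  rw [← hn] at ht
  obtain ⟨t', hpuv, -⟩ := ht.exists_of_append
  obtain ⟨r, -, huv⟩ := hpuv.exists_of_append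
  obtain ⟨s, hu, hv⟩ := huv.exists_of_append
  have hu0 := hu.count_zero_add
  have hv0 := hv.count_zero_add
  have hu2 := hu.two_mul_binomC
  have hv2 := hv.two_mul_binomC
  rw [hab 0, hab 2] at hu0
  rw [hab 2] at hu2
  cases r <;> cases s <;> cases t' <;> simp at hu0 hv0 hu2 hv2 <;> omega
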